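/- (The limiting distribution is proper: z·m(z) → −1.) Let H be a Borel probability measure on [0,∞)×[0,∞), let c > 0, and let m, g : ℂ⁺ → ℂ (ℂ⁺ the open upper half-plane) be functions such that for every z ∈ ℂ⁺: Im m(z) ≥ 0, Im(z·m(z)) ≥ 0, Im g(z) ≥ 0, Im(z·g(z)) ≥ 0, 1 + c·g(z) ≠ 0, and m(z) = ∫ dH(s,t) / ( s·t/(1 + c·g(z)) − (1 + c·m(z)·t)·z + t·(1−c) ). Then for every s ≥ 0, t ≥ 0 and z = x + iv ∈ ℂ⁺ the denominator has imaginary part at most −v (in particular it is nonzero), and for each fixed x ∈ ℝ, (x+iv)·m(x+iv) → −1 as v → ∞. -/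

import Mathlib

open MeasureTheory Complex Filter Topology

noncomputable section

/-- The denominator appearing in the first equation of the limiting system for
information-plus-correlated-noise matrices. -/
def den13 (c : ℝ) (m g : ℂ) (z : ℂ) (p : ℝ × ℝ) : ℂ :=
  p.1 * p.2 / (1 + c * g) - (1 + c * m * p.2) * z + p.2 * (1 - c)

theorem den13_im_le {c s t : ℝ} {m g z : ℂ} (hc : 0 < c) (hs : 0 ≤ s) (ht : 0 ≤ t)
    (hzm : 0 ≤ (z * m).im) (hg : 0 ≤ g.im) : (den13 c m g z (s, t)).im ≤ -z.im := by
  have hinv : ((s : ℂ) * t / (1 + c * g)).im ≤ 0 := by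
    have hrw : (s : ℂ) * t / (1 + c * g) = ((s * t : ℝ) : ℂ) * (1 + c * g)⁻¹ := by
      push_cast
      rw [div_eq_mul_inv]
    rw [hrw, Complex.im_ofReal_mul, Complex.inv_im]
    have him : (1 + (c : ℂ) * g).im = c * g.im := by simp
    rw [him]
    refine mul_nonpos_of_nonneg_of_nonpos (mul_nonneg hs ht) ?_
    exact div_nonpos_of_nonpos_of_nonneg (neg_nonpos.2 (mul_nonneg hc.le hg))
      (Complex.normSq_nonneg _)
  have hsplit : den13 c m g z (s, t) =
      (s : ℂ) * t / (1 + c * g) - z - ((c * t : ℝ) : ℂ) * (z * m) + ((t * (1 - c) : ℝ) : ℂ) := by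
    simp only [den13]
    push_cast
    ring
  rw [hsplit, Complex.add_im, Complex.sub_im, Complex.sub_im, Complex.im_ofReal_mul,
    Complex.ofReal_im]
  have := mul_nonneg (mul_nonneg hc.le ht) hzm
  linarith

theorem norm_den13_inv_le {c : ℝ} {m g z : ℂ} {p : ℝ × ℝ} (hc : 0 < c)
    (hp : 0 ≤ p.1 ∧ 0 ≤ p.2) (hz : 0 < z.im) (hzm : 0 ≤ (z * m).im) (hg : 0 ≤ g.im) :
    ‖(den13 c m g z p)⁻¹‖ ≤ z.im⁻¹ := by
  have him : (den13 c m g z p).im ≤ -z.im := den13_im_le hc hp.1 hp.2 hzm hg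
  rw [norm_inv]
  refine inv_anti₀ hz ?_
  refine le_trans ?_ (Complex.abs_im_le_norm _)
  rw [abs_of_neg (by linarith)]
  linarith

theorem measurable_den13 (c : ℝ) (m g z : ℂ) : Measurable (den13 c m g z) := by
  unfold den13
  fun_prop

/-- If `z → ∞`, `z (1 + c g) → ∞` and `m → 0`, then `z / den13` tends to `-1` pointwise. -/
theorem tendsto_mul_den13_inv {ι : Type*} {l : Filter ι} {c : ℝ} {m g z : ι → ℂ} (p : ℝ × ℝ)
    (hz : Tendsto (fun i => (z i)⁻¹) l (𝓝 0)) (hz0 : ∀ᶠ i in l, z i ≠ 0)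
    (hm : Tendsto m l (𝓝 0))
    (hzg : Tendsto (fun i => (z i * (1 + c * g i))⁻¹) l (𝓝 0)) :
    Tendsto (fun i => z i * (den13 c (m i) (g i) (z i) p)⁻¹) l (𝓝 (-1)) := by
  have hlim : Tendsto (fun i => (p.1 * p.2 : ℂ) * (z i * (1 + c * g i))⁻¹
      - (1 + c * m i * p.2) + p.2 * (1 - c) * (z i)⁻¹) l (𝓝 (-1)) := by
    have h := ((hzg.const_mul (p.1 * p.2 : ℂ)).sub
      (((hm.const_mul (c : ℂ)).mul_const (p.2 : ℂ)).const_add 1)).add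
      (hz.const_mul ((p.2 : ℂ) * (1 - c)))
    simpa using h
  have hinv := hlim.inv₀ (by norm_num)
  rw [inv_neg, inv_one] at hinv
  refine hinv.congr' ?_
  filter_upwards [hz0] with i hi
  have hden : (p.1 * p.2 : ℂ) * (z i * (1 + c * g i))⁻¹ - (1 + c * m i * p.2)
      + p.2 * (1 - c) * (z i)⁻¹ = (z i)⁻¹ * den13 c (m i) (g i) (z i) p := by
    simp only [den13, mul_inv, div_eq_mul_inv]
    linear_combination (1 + c * m i * p.2) * inv_mul_cancel₀ hi
  rw [hden, mul_inv, inv_inv]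

theorem tendsto_inv_zero_of_le_im {ι : Type*} {l : Filter ι} {w : ι → ℂ} {v : ι → ℝ}
    (hv : Tendsto v l atTop) (h : ∀ᶠ i in l, v i ≤ (w i).im) :
    Tendsto (fun i => (w i)⁻¹) l (𝓝 0) := by
  refine tendsto_inv₀_cobounded.comp (tendsto_norm_atTop_iff_cobounded.1 ?_)
  refine tendsto_atTop_mono' l ?_ hv
  filter_upwards [h] with i hi
  exact hi.trans ((le_abs_self _).trans (Complex.abs_im_le_norm _))

theorem stmt13 (H : Measure (ℝ × ℝ)) [IsProbabilityMeasure H]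
    (hHsupp : ∀ᵐ p ∂H, 0 ≤ p.1 ∧ 0 ≤ p.2)
    (c : ℝ) (hc : 0 < c)
    (m g : ℂ → ℂ)
    (hm : ∀ z : ℂ, 0 < z.im → 0 ≤ (m z).im)
    (hzm : ∀ z : ℂ, 0 < z.im → 0 ≤ (z * m z).im)
    (hg : ∀ z : ℂ, 0 < z.im → 0 ≤ (g z).im)
    (hzg : ∀ z : ℂ, 0 < z.im → 0 ≤ (z * g z).im)
    (hcg : ∀ z : ℂ, 0 < z.im → 1 + c * g z ≠ 0)
    (heq : ∀ z : ℂ, 0 < z.im →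
      m z = ∫ p, (den13 c (m z) (g z) z p)⁻¹ ∂H) :
    (∀ (s t : ℝ) (z : ℂ), 0 ≤ s → 0 ≤ t → 0 < z.im →
      (den13 c (m z) (g z) z (s, t)).im ≤ -z.im ∧ den13 c (m z) (g z) z (s, t) ≠ 0) ∧
    ∀ x : ℝ, Tendsto
      (fun v : ℝ => ((x : ℂ) + v * Complex.I) * m ((x : ℂ) + v * Complex.I))
      atTop (𝓝 (-1)) := by
  refine ⟨fun s t z hs ht hz => ?_, fun x => ?_⟩
  · have him := den13_im_le hc hs ht (hzm z hz) (hg z hz)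
    refine ⟨him, fun h0 => ?_⟩
    rw [h0, Complex.zero_im] at him
    linarith
  set z : ℝ → ℂ := fun v => (x : ℂ) + v * Complex.I with hzdef
  have him : ∀ v, (z v).im = v := fun v => by simp [hzdef]
  have hbound : ∀ v : ℝ, 0 < v →
      ∀ᵐ p ∂H, ‖(den13 c (m (z v)) (g (z v)) (z v) p)⁻¹‖ ≤ v⁻¹ := by
    intro v hv
    have hv' : 0 < (z v).im := by rwa [him]
    filter_upwards [hHsupp] with p hp
    simpa only [him] using norm_den13_inv_le hc hp hv' (hzm _ hv') (hg _ hv')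
  have hmlim : Tendsto (fun v => m (z v)) atTop (𝓝 0) := by
    refine squeeze_zero_norm' ?_ tendsto_inv_atTop_zero
    filter_upwards [eventually_gt_atTop 0] with v hv
    rw [heq (z v) (by rwa [him])]
    simpa using norm_integral_le_of_norm_le_const (hbound v hv)
  have hzlim : Tendsto (fun v => (z v)⁻¹) atTop (𝓝 0) :=
    tendsto_inv_zero_of_le_im tendsto_id (Eventually.of_forall fun v => (him v).ge)
  have hzglim : Tendsto (fun v => (z v * (1 + c * g (z v)))⁻¹) atTop (𝓝 0) := by
    refine tendsto_inv_zero_of_le_im tendsto_id ?_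
    filter_upwards [eventually_gt_atTop 0] with v hv
    have hrw : z v * (1 + c * g (z v)) = z v + (c : ℂ) * (z v * g (z v)) := by ring
    rw [hrw, Complex.add_im, Complex.im_ofReal_mul, him]
    have := mul_nonneg hc.le (hzg (z v) (by rwa [him]))
    simpa using this
  have hz0 : ∀ᶠ v in atTop, z v ≠ 0 := by
    filter_upwards [eventually_gt_atTop 0] with v hv h0
    have := him v
    rw [h0, Complex.zero_im] at this
    exact hv.ne this
  have hlim : Tendsto
      (fun v => ∫ p, z v * (den13 c (m (z v)) (g (z v)) (z v) p)⁻¹ ∂H)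
      atTop (𝓝 (∫ _, (-1 : ℂ) ∂H)) := by
    refine tendsto_integral_filter_of_dominated_convergence (fun _ => |x| + 1) ?_ ?_
      (integrable_const _) ?_
    · exact Eventually.of_forall fun v =>
        ((measurable_den13 _ _ _ _).inv.const_mul _).aestronglyMeasurable
    · filter_upwards [eventually_ge_atTop 1] with v hv
      have hv0 : 0 < v := by linarith
      filter_upwards [hbound v hv0] with p hp
      have hzn : ‖z v‖ ≤ |x| + v := by
        refine (norm_add_le _ _).trans ?_
        simp [abs_of_pos hv0]
      rw [norm_mul]
      calc ‖z v‖ * ‖(den13 c (m (z v)) (g (z v)) (z v) p)⁻¹‖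
          ≤ (|x| + v) * v⁻¹ := by gcongr
        _ ≤ |x| + 1 := by
          rw [add_mul, mul_inv_cancel₀ hv0.ne']
          gcongr
          exact mul_le_of_le_one_right (abs_nonneg x) (inv_le_one_of_one_le₀ hv)
    · exact Eventually.of_forall fun p => tendsto_mul_den13_inv p hzlim hz0 hmlim hzglim
  rw [integral_const, probReal_univ, one_smul] at hlim
  refine hlim.congr' ?_
  filter_upwards [eventually_gt_atTop 0] with v hv
  rw [integral_const_mul, ← heq (z v) (by rwa [him])]

end
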